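/- For n = 6, the set B = {{0,3},{0,4},{1,3},{1,4},{2,5}} is a saturated blocker of the convex hexagon; it has exactly 5 = n−1 edges, so it is a saturated blocker that is not of minimum size n−2. -/

import Mathlib

open Finset

namespace ConvexBlocker

/-- `c` lies strictly inside the (positively oriented) open arc from `a` to `b`. -/
def Btw (n : ℕ) (a c b : ZMod n) : Prop :=
  0 < (c - a).val ∧ (c - a).val < (b - a).val

/-- Two edges of the convex `n`-gon cross: their endpoints are four pairwise distinct
vertices which interleave in the cyclic order. -/
def Cross (n : ℕ) (e f : Sym2 (ZMod n)) : Prop :=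
  ∃ a b c d : ZMod n, e = s(a, b) ∧ f = s(c, d) ∧
    0 < (c - a).val ∧ (c - a).val < (b - a).val ∧ (b - a).val < (d - a).val

/-- `e` is an edge (an unordered pair of distinct vertices) of the `n`-gon. -/
def IsEdge (n : ℕ) (e : Sym2 (ZMod n)) : Prop :=
  ∃ a b : ZMod n, e = s(a, b) ∧ a ≠ b

/-- `e` is a diagonal of the convex `n`-gon: an edge of order at least 2, i.e. both open
arcs between its endpoints are nonempty. -/
def IsDiagonal (n : ℕ) (e : Sym2 (ZMod n)) : Prop :=
  ∃ a b : ZMod n, e = s(a, b) ∧ a ≠ b ∧ (∃ c, Btw n a c b) ∧ (∃ d, Btw n b d a)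

/-- A triangulation of the convex `n`-gon: an inclusion-maximal set of pairwise
non-crossing diagonals. -/
def IsTriangulation (n : ℕ) (T : Finset (Sym2 (ZMod n))) : Prop :=
  (∀ e ∈ T, IsDiagonal n e) ∧
  (∀ e ∈ T, ∀ f ∈ T, ¬ Cross n e f) ∧
  (∀ e, IsDiagonal n e → e ∉ T → ∃ f ∈ T, Cross n e f)

/-- A blocker of the convex `n`-gon: a set of edges meeting every triangulation. -/
def IsBlocker (n : ℕ) (B : Finset (Sym2 (ZMod n))) : Prop :=
  (∀ e ∈ B, IsEdge n e) ∧
  ∀ T : Finset (Sym2 (ZMod n)), IsTriangulation n T → (B ∩ T).Nonempty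

/-- A saturated blocker of the convex `n`-gon. -/
def IsSaturatedBlocker (n : ℕ) (B : Finset (Sym2 (ZMod n))) : Prop :=
  IsBlocker n B ∧ ∀ e ∈ B, ¬ IsBlocker n (B.erase e)

/-- `e` is an edge of the sub-polygon on the vertex set `S`. -/
def IsEdgeOn (n : ℕ) (S : Finset (ZMod n)) (e : Sym2 (ZMod n)) : Prop :=
  ∃ a b : ZMod n, e = s(a, b) ∧ a ∈ S ∧ b ∈ S ∧ a ≠ b

/-- `e` is a diagonal of the sub-polygon on `S` (with the inherited cyclic order):
its endpoints are distinct members of `S` which are not cyclically consecutive in `S`. -/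
def IsDiagonalOn (n : ℕ) (S : Finset (ZMod n)) (e : Sym2 (ZMod n)) : Prop :=
  ∃ a b : ZMod n, e = s(a, b) ∧ a ∈ S ∧ b ∈ S ∧ a ≠ b ∧
    (∃ c ∈ S, Btw n a c b) ∧ (∃ d ∈ S, Btw n b d a)

/-- A triangulation of the sub-polygon on `S`. -/
def IsTriangulationOn (n : ℕ) (S : Finset (ZMod n)) (T : Finset (Sym2 (ZMod n))) : Prop :=
  (∀ e ∈ T, IsDiagonalOn n S e) ∧
  (∀ e ∈ T, ∀ f ∈ T, ¬ Cross n e f) ∧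
  (∀ e, IsDiagonalOn n S e → e ∉ T → ∃ f ∈ T, Cross n e f)

/-- A blocker of the sub-polygon on `S`. -/
def IsBlockerOn (n : ℕ) (S : Finset (ZMod n)) (B : Finset (Sym2 (ZMod n))) : Prop :=
  (∀ e ∈ B, IsEdgeOn n S e) ∧
  ∀ T : Finset (Sym2 (ZMod n)), IsTriangulationOn n S T → (B ∩ T).Nonempty

/-- A saturated blocker of the sub-polygon on `S`. -/
def IsSaturatedBlockerOn (n : ℕ) (S : Finset (ZMod n)) (B : Finset (Sym2 (ZMod n))) : Prop :=
  IsBlockerOn n S B ∧ ∀ e ∈ B, ¬ IsBlockerOn n S (B.erase e)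

/-- The degree of the vertex `v` in the set of edges `B`. -/
noncomputable def degB (n : ℕ) (B : Finset (Sym2 (ZMod n))) (v : ZMod n) : ℕ :=
  (B.filter (fun e => v ∈ e)).card

end ConvexBlocker

namespace ConvexBlocker

/-- The vertices `a, c, b, d` are pairwise distinct and occur in this cyclic order. -/
def Interleave (n : ℕ) (a b c d : ZMod n) : Prop :=
  0 < (c - a).val ∧ (c - a).val < (b - a).val ∧ (b - a).val < (d - a).val

instance (n : ℕ) (a b c d : ZMod n) : Decidable (Interleave n a b c d) :=
  inferInstanceAs (Decidable (_ ∧ _ ∧ _))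

instance (n : ℕ) (a c b : ZMod n) : Decidable (Btw n a c b) :=
  inferInstanceAs (Decidable (_ ∧ _))

theorem cross_mk_iff (n : ℕ) (a b c d : ZMod n) :
    Cross n s(a, b) s(c, d) ↔ Interleave n a b c d ∨ Interleave n b a c d ∨
      Interleave n a b d c ∨ Interleave n b a d c := by
  constructor
  · rintro ⟨a', b', c', d', he, hf, h⟩
    rw [Sym2.eq_iff] at he hf
    rcases he with ⟨rfl, rfl⟩ | ⟨rfl, rfl⟩ <;> rcases hf with ⟨rfl, rfl⟩ | ⟨rfl, rfl⟩
    · exact Or.inl h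
    · exact Or.inr (Or.inr (Or.inl h))
    · exact Or.inr (Or.inl h)
    · exact Or.inr (Or.inr (Or.inr h))
  · rintro (h | h | h | h)
    · exact ⟨a, b, c, d, rfl, rfl, h⟩
    · exact ⟨b, a, c, d, Sym2.eq_swap, rfl, h⟩
    · exact ⟨a, b, d, c, rfl, Sym2.eq_swap, h⟩
    · exact ⟨b, a, d, c, Sym2.eq_swap, Sym2.eq_swap, h⟩

/-- Three pairwise non-crossing diagonals, such that every other diagonal crosses one of
them, form a triangulation. -/
theorem isTriangulation_triple {n : ℕ} {a b c d e f : ZMod n}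
    (h₁ : IsDiagonal n s(a, b)) (h₂ : IsDiagonal n s(c, d)) (h₃ : IsDiagonal n s(e, f))
    (hcross : ∀ p ∈ [(a, b), (c, d), (e, f)], ∀ q ∈ [(a, b), (c, d), (e, f)],
      ¬ Interleave n p.1 p.2 q.1 q.2 ∧ ¬ Interleave n p.2 p.1 q.1 q.2 ∧
      ¬ Interleave n p.1 p.2 q.2 q.1 ∧ ¬ Interleave n p.2 p.1 q.2 q.1)
    (hmax : ∀ x y : ZMod n, (∃ z, Btw n x z y) → (∃ z, Btw n y z x) →
      s(x, y) = s(a, b) ∨ s(x, y) = s(c, d) ∨ s(x, y) = s(e, f) ∨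
      ∃ q ∈ [(a, b), (c, d), (e, f)],
        Interleave n x y q.1 q.2 ∨ Interleave n y x q.1 q.2 ∨
        Interleave n x y q.2 q.1 ∨ Interleave n y x q.2 q.1) :
    IsTriangulation n {s(a, b), s(c, d), s(e, f)} := by
  have hmem : ∀ g : Sym2 (ZMod n), g ∈ ({s(a, b), s(c, d), s(e, f)} : Finset (Sym2 (ZMod n))) ↔
      ∃ p ∈ [(a, b), (c, d), (e, f)], g = s(p.1, p.2) := by
    intro g
    simp
  refine ⟨?_, ?_, ?_⟩
  · intro g hg
    simp only [mem_insert, mem_singleton] at hg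
    rcases hg with rfl | rfl | rfl <;> assumption
  · intro g hg g' hg'
    obtain ⟨p, hp, rfl⟩ := (hmem g).1 hg
    obtain ⟨q, hq, rfl⟩ := (hmem g').1 hg'
    have := hcross p hp q hq
    rw [cross_mk_iff]
    tauto
  · rintro g ⟨x, y, rfl, -, hxy, hyx⟩ hg
    simp only [mem_insert, mem_singleton, not_or] at hg
    rcases hmax x y hxy hyx with h | h | h | ⟨q, hq, h⟩
    · exact absurd h hg.1
    · exact absurd h hg.2.1
    · exact absurd h hg.2.2
    · exact ⟨s(q.1, q.2), (hmem _).2 ⟨q, hq, rfl⟩, (cross_mk_iff ..).2 h⟩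

theorem not_isBlocker_of_disjoint {n : ℕ} {B T : Finset (Sym2 (ZMod n))}
    (hT : IsTriangulation n T) (h : B ∩ T = ∅) : ¬ IsBlocker n B := fun hB =>
  (hB.2 T hT).ne_empty h

/-- A diagonal together with all diagonals crossing it is a blocker. -/
theorem isBlocker_of_crossing_mem {n : ℕ} {B : Finset (Sym2 (ZMod n))} {e : Sym2 (ZMod n)}
    (hB : ∀ f ∈ B, IsEdge n f) (he : IsDiagonal n e) (heB : e ∈ B)
    (hcross : ∀ f, Cross n e f → f ∈ B) : IsBlocker n B := by
  refine ⟨hB, fun T hT => ?_⟩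
  by_cases heT : e ∈ T
  · exact ⟨e, mem_inter.2 ⟨heB, heT⟩⟩
  · obtain ⟨f, hfT, hf⟩ := hT.2.2 e he heT
    exact ⟨f, mem_inter.2 ⟨hcross f hf, hfT⟩⟩

theorem isDiagonal_mk {n : ℕ} {a b : ZMod n} (h : a ≠ b ∧ (∃ c, Btw n a c b) ∧ ∃ d, Btw n b d a) :
    IsDiagonal n s(a, b) :=
  ⟨a, b, rfl, h⟩

end ConvexBlocker

open ConvexBlocker in
/-- for `n = 6`, the set `B = {{0,3},{0,4},{1,3},{1,4},{2,5}}` is a saturated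
blocker of the convex hexagon with exactly `5 = n - 1` edges (so it is a saturated blocker
which is not of minimum size `n - 2 = 4`). -/
theorem hexagon_saturated_blocker_of_size_five :
    IsSaturatedBlocker 6
      ({s((0 : ZMod 6), 3), s((0 : ZMod 6), 4), s((1 : ZMod 6), 3),
        s((1 : ZMod 6), 4), s((2 : ZMod 6), 5)} : Finset (Sym2 (ZMod 6))) ∧
    ({s((0 : ZMod 6), 3), s((0 : ZMod 6), 4), s((1 : ZMod 6), 3),
        s((1 : ZMod 6), 4), s((2 : ZMod 6), 5)} : Finset (Sym2 (ZMod 6))).card = 5 := by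
  refine ⟨⟨isBlocker_of_crossing_mem (e := s(2, 5)) ?_ (isDiagonal_mk (by decide)) (by decide) ?_,
    ?_⟩, by decide⟩
  · intro f hf
    simp only [mem_insert, mem_singleton] at hf
    rcases hf with rfl | rfl | rfl | rfl | rfl <;> exact ⟨_, _, rfl, by decide⟩
  · intro f
    induction f with | _ x y
    rw [cross_mk_iff]
    revert x y
    decide
  · intro e he
    simp only [mem_insert, mem_singleton] at he
    rcases he with rfl | rfl | rfl | rfl | rfl
    · exact not_isBlocker_of_disjoint (isTriangulation_triple (n := 6)
        (a := 0) (b := 3) (c := 0) (d := 2) (e := 3) (f := 5)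
        (isDiagonal_mk (by decide)) (isDiagonal_mk (by decide)) (isDiagonal_mk (by decide))
        (by decide) (by decide)) (by decide)
    · exact not_isBlocker_of_disjoint (isTriangulation_triple (n := 6)
        (a := 0) (b := 4) (c := 0) (d := 2) (e := 2) (f := 4)
        (isDiagonal_mk (by decide)) (isDiagonal_mk (by decide)) (isDiagonal_mk (by decide))
        (by decide) (by decide)) (by decide)
    · exact not_isBlocker_of_disjoint (isTriangulation_triple (n := 6)
        (a := 1) (b := 3) (c := 3) (d := 5) (e := 1) (f := 5)
        (isDiagonal_mk (by decide)) (isDiagonal_mk (by decide)) (isDiagonal_mk (by decide))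
        (by decide) (by decide)) (by decide)
    · exact not_isBlocker_of_disjoint (isTriangulation_triple (n := 6)
        (a := 1) (b := 4) (c := 2) (d := 4) (e := 1) (f := 5)
        (isDiagonal_mk (by decide)) (isDiagonal_mk (by decide)) (isDiagonal_mk (by decide))
        (by decide) (by decide)) (by decide)
    · exact not_isBlocker_of_disjoint (isTriangulation_triple (n := 6)
        (a := 2) (b := 5) (c := 2) (d := 4) (e := 1) (f := 5)
        (isDiagonal_mk (by decide)) (isDiagonal_mk (by decide)) (isDiagonal_mk (by decide))
        (by decide) (by decide)) (by decide)
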